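/- arXiv:2605.08818 — 2 statements merged into one kernel-verified Lean document; each statement's English description precedes it below -/
import Mathlib

section
/- Let n, m ≥ 1, α ∈ (0,1), β ≥ 0, and set Q = (n + m(β+1−α))/(1−α). There exists a constant C > 0 such that for every f ∈ C_c^∞(ℝ^{n+m}), (∫_{ℝ^{n+m}} |f(ξ)|^{Q/(Q−1)} dξ)^{(Q−1)/Q} ≤ C ∫_{ℝ^{n+m}} |∇_L f(ξ)| dξ. (This is the Sobolev inequality (S_Q^1), equivalent to the isoperimetric inequality |Ω|^{(Q−1)/Q} ≤ C P(Ω) on the Grushin space.) -/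
open MeasureTheory

/-- The pointwise norm of the Grushin gradient
`∇_L f = (|x|^α ∇_x f, |x|^β ∇_y f)` of `f : ℝⁿ × ℝᵐ → ℝ`,
i.e. `|∇_L f(x,y)|² = |x|^{2α} |∇_x f|² + |x|^{2β} |∇_y f|²`. -/
noncomputable def gradLNorm (n m : ℕ) (α β : ℝ)
    (f : EuclideanSpace ℝ (Fin n) × EuclideanSpace ℝ (Fin m) → ℝ)
    (ξ : EuclideanSpace ℝ (Fin n) × EuclideanSpace ℝ (Fin m)) : ℝ :=
  Real.sqrt (‖ξ.1‖ ^ (2 * α) * ‖gradient (fun x => f (x, ξ.2)) ξ.1‖ ^ 2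
    + ‖ξ.1‖ ^ (2 * β) * ‖gradient (fun y => f (ξ.1, y)) ξ.2‖ ^ 2)

/-- The homogeneous dimension `Q = (n + m(β+1−α))/(1−α)`. -/
noncomputable def homDim (n m : ℕ) (α β : ℝ) : ℝ :=
  (n + m * (β + 1 - α)) / (1 - α)

open Set Function Topology
open scoped ENNReal

lemma HasCompactSupport.enorm_le_lintegral_Ioi_deriv {h : ℝ → ℝ} (hh : ContDiff ℝ 1 h)
    (hc : HasCompactSupport h) (t : ℝ) : ‖h t‖ₑ ≤ ∫⁻ s in Ioi t, ‖deriv h s‖ₑ := by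
  have := enorm_integral_le_lintegral_enorm (μ := volume.restrict (Ioi t)) (deriv h)
  rwa [HasCompactSupport.integral_Ioi_deriv_eq hh hc, enorm_neg] at this

/-- The fundamental theorem of calculus with a weight that grows away from the origin: integrate
from `t` to infinity in the direction in which the weight increases. -/
lemma HasCompactSupport.weight_mul_enorm_le_lintegral_deriv {h : ℝ → ℝ} (hh : ContDiff ℝ 1 h)
    (hc : HasCompactSupport h) {w : ℝ → ℝ≥0∞} (hw : ∀ s t, |s| ≤ |t| → w s ≤ w t) (t : ℝ) :
    w t * ‖h t‖ₑ ≤ ∫⁻ s, w s * ‖deriv h s‖ₑ := by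
  have key : ∀ S : Set ℝ, MeasurableSet S → (∀ s ∈ S, |t| ≤ |s|) →
      ‖h t‖ₑ ≤ ∫⁻ s in S, ‖deriv h s‖ₑ → w t * ‖h t‖ₑ ≤ ∫⁻ s, w s * ‖deriv h s‖ₑ := by
    intro S hS hts hle
    have hmeas : Measurable fun s => ‖deriv h s‖ₑ := (measurable_deriv h).enorm
    calc w t * ‖h t‖ₑ ≤ w t * ∫⁻ s in S, ‖deriv h s‖ₑ := by gcongr
      _ = ∫⁻ s in S, w t * ‖deriv h s‖ₑ := (lintegral_const_mul _ hmeas).symm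
      _ ≤ ∫⁻ s in S, w s * ‖deriv h s‖ₑ := by
          refine setLIntegral_mono' hS fun s hs => ?_
          gcongr
          exact hw _ _ (hts s hs)
      _ ≤ ∫⁻ s, w s * ‖deriv h s‖ₑ := setLIntegral_le_lintegral _ _
  rcases le_total 0 t with ht | ht
  · refine key (Ioi t) measurableSet_Ioi (fun s hs => ?_) (hc.enorm_le_lintegral_Ioi_deriv hh t)
    exact abs_le_abs_of_nonneg ht (le_of_lt hs)
  · refine key (Iic t) measurableSet_Iic (fun s hs => ?_)
      (HasCompactSupport.enorm_le_lintegral_Ici_deriv hh hc t)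
    rw [abs_of_nonpos ht, abs_of_nonpos (le_trans hs ht)]
    exact neg_le_neg hs

section EuclideanSpace

variable {n : ℕ}

lemma EuclideanSpace.hasDerivAt_toLp_update (x : Fin n → ℝ) (j : Fin n) (t : ℝ) :
    HasDerivAt (fun s => WithLp.toLp 2 (update x j s)) (EuclideanSpace.single j (1 : ℝ)) t := by
  have h := (PiLp.continuousLinearEquiv 2 ℝ (fun _ : Fin n => ℝ)).symm.hasFDerivAt.comp_hasDerivAt t
    (hasDerivAt_update x j t)
  exact h

lemma EuclideanSpace.contDiff_toLp_update (x : Fin n → ℝ) (j : Fin n) :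
    ContDiff ℝ 1 (fun s => WithLp.toLp 2 (update x j s)) :=
  (PiLp.continuousLinearEquiv 2 ℝ (fun _ : Fin n => ℝ)).symm.contDiff.comp (contDiff_update 1 x j)

lemma EuclideanSpace.isClosedEmbedding_toLp_update (x : Fin n → ℝ) (j : Fin n) :
    IsClosedEmbedding (fun s => WithLp.toLp 2 (update x j s)) :=
  (PiLp.continuousLinearEquiv 2 ℝ
    (fun _ : Fin n => ℝ)).symm.toHomeomorph.isClosedEmbedding.comp (isClosedEmbedding_update x j)

lemma EuclideanSpace.norm_toLp_update_le (x : Fin n → ℝ) (j : Fin n) {s t : ℝ} (h : |s| ≤ |t|) :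
    ‖WithLp.toLp 2 (update x j s)‖ ≤ ‖WithLp.toLp 2 (update x j t)‖ := by
  rw [EuclideanSpace.norm_eq, EuclideanSpace.norm_eq]
  refine Real.sqrt_le_sqrt (Finset.sum_le_sum fun i _ => ?_)
  rcases eq_or_ne i j with rfl | hi
  · simpa using sq_le_sq.2 h
  · simp [update_of_ne hi]

/-- On every line parallel to a coordinate axis, `|x|^a |g(x)|` is bounded by the integral of
`|x|^a |Dg|` over the line. -/
lemma EuclideanSpace.rpow_norm_mul_enorm_le_lintegral_update {g : EuclideanSpace ℝ (Fin n) → ℝ}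
    (hg : ContDiff ℝ 1 g) (hc : HasCompactSupport g) {a : ℝ} (ha : 0 ≤ a) (x : Fin n → ℝ)
    (j : Fin n) :
    ENNReal.ofReal (‖WithLp.toLp 2 x‖ ^ a) * ‖g (WithLp.toLp 2 x)‖ₑ ≤
      ∫⁻ t, ENNReal.ofReal (‖WithLp.toLp 2 (update x j t)‖ ^ a) *
        ‖fderiv ℝ g (WithLp.toLp 2 (update x j t))‖ₑ := by
  have h := HasCompactSupport.weight_mul_enorm_le_lintegral_deriv
    (h := fun t => g (WithLp.toLp 2 (update x j t)))
    (hg.comp (contDiff_toLp_update x j))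
    (hc.comp_isClosedEmbedding (isClosedEmbedding_toLp_update x j))
    (w := fun t => ENNReal.ofReal (‖WithLp.toLp 2 (update x j t)‖ ^ a))
    (fun s t hst => ENNReal.ofReal_le_ofReal
      (Real.rpow_le_rpow (norm_nonneg _) (norm_toLp_update_le x j hst) ha)) (x j)
  simp only [update_eq_self] at h
  refine h.trans (lintegral_mono fun t => ?_)
  dsimp only
  gcongr
  have hd := ((hg.differentiable one_ne_zero _).hasFDerivAt.comp_hasDerivAt t
    (hasDerivAt_toLp_update x j t)).deriv
  rw [show deriv (fun t => g (WithLp.toLp 2 (update x j t))) t = _ from hd]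
  refine (ContinuousLinearMap.le_opENorm _ _).trans ?_
  simp [← ofReal_norm]

end EuclideanSpace

section Hardy

variable {E : Type*} [NormedAddCommGroup E] [NormedSpace ℝ E] [MeasurableSpace E] [BorelSpace E]
  [FiniteDimensional ℝ E] (μ : Measure E) [μ.IsAddHaarMeasure]

lemma MeasureTheory.lintegral_comp_smul_of_pos {s : ℝ} (hs : 0 < s) {G : E → ℝ≥0∞}
    (hG : Measurable G) :
    ∫⁻ x, G (s • x) ∂μ = ENNReal.ofReal (s ^ (-(Module.finrank ℝ E : ℝ))) * ∫⁻ x, G x ∂μ := by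
  rw [← lintegral_map hG (measurable_const_smul s), Measure.map_addHaar_smul μ hs.ne',
    lintegral_smul_measure, smul_eq_mul, abs_of_nonneg (by positivity), Real.rpow_neg hs.le,
    Real.rpow_natCast]

/-- The `L¹` Hardy inequality with weight `|x|^(a-1)`. -/
lemma HasCompactSupport.lintegral_rpow_norm_mul_enorm_le [Nontrivial E] {g : E → ℝ}
    (hg : ContDiff ℝ 1 g)
    (hc : HasCompactSupport g) {a : ℝ} (hd : 1 < a + Module.finrank ℝ E) :
    ∫⁻ x, ENNReal.ofReal (‖x‖ ^ (a - 1)) * ‖g x‖ₑ ∂μ ≤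
      ENNReal.ofReal (1 / (a + Module.finrank ℝ E - 1)) *
        ∫⁻ x, ENNReal.ofReal (‖x‖ ^ a) * ‖fderiv ℝ g x‖ₑ ∂μ := by
  set d : ℝ := (Module.finrank ℝ E : ℝ)
  set G : E → ℝ≥0∞ := fun x => ENNReal.ofReal (‖x‖ ^ a) * ‖fderiv ℝ g x‖ₑ
  have hcd : Continuous (fderiv ℝ g) := hg.continuous_fderiv one_ne_zero
  have hG : Measurable G := by fun_prop
  have hpt : ∀ x : E, x ≠ 0 → ENNReal.ofReal (‖x‖ ^ (a - 1)) * ‖g x‖ₑ ≤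
      ∫⁻ s in Ioi (1 : ℝ), ENNReal.ofReal (s ^ (-a)) * G (s • x) := by
    intro x hx
    have hx0 : 0 < ‖x‖ := norm_pos_iff.2 hx
    have hray : ContDiff ℝ 1 fun s : ℝ => g (s • x) := hg.comp (contDiff_id.smul contDiff_const)
    have hce : IsClosedEmbedding fun s : ℝ => s • x := isClosedEmbedding_smul_left hx
    have h1 : ‖g x‖ₑ ≤ ∫⁻ s in Ioi (1 : ℝ), ‖deriv (g ∘ fun s : ℝ => s • x) s‖ₑ := by
      simpa only [comp_def, one_smul] using
        (hc.comp_isClosedEmbedding hce).enorm_le_lintegral_Ioi_deriv hray 1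
    have hmeas : Measurable fun s => ‖deriv (g ∘ fun s : ℝ => s • x) s‖ₑ :=
      (measurable_deriv _).enorm
    calc ENNReal.ofReal (‖x‖ ^ (a - 1)) * ‖g x‖ₑ
        ≤ ENNReal.ofReal (‖x‖ ^ (a - 1)) *
          ∫⁻ s in Ioi (1 : ℝ), ‖deriv (g ∘ fun s : ℝ => s • x) s‖ₑ := by gcongr
      _ = ∫⁻ s in Ioi (1 : ℝ), ENNReal.ofReal (‖x‖ ^ (a - 1)) *
          ‖deriv (g ∘ fun s : ℝ => s • x) s‖ₑ := (lintegral_const_mul _ hmeas).symm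
      _ ≤ _ := by
        refine setLIntegral_mono' measurableSet_Ioi fun s hs => ?_
        have hs0 : (0 : ℝ) < s := zero_lt_one.trans hs
        have hder : deriv (g ∘ fun s : ℝ => s • x) s = fderiv ℝ g (s • x) x := by
          have := (hg.differentiable one_ne_zero (s • x)).hasFDerivAt.comp_hasDerivAt s
            ((hasDerivAt_id s).smul_const x)
          simpa using this.deriv
        rw [hder]
        calc ENNReal.ofReal (‖x‖ ^ (a - 1)) * ‖fderiv ℝ g (s • x) x‖ₑ
            ≤ ENNReal.ofReal (‖x‖ ^ (a - 1)) * (‖fderiv ℝ g (s • x)‖ₑ * ‖x‖ₑ) := by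
              gcongr; exact ContinuousLinearMap.le_opENorm _ _
          _ = ENNReal.ofReal (s ^ (-a)) * G (s • x) := by
              simp only [G, ← mul_assoc]
              rw [mul_right_comm, ← ofReal_norm x, ← ENNReal.ofReal_mul (by positivity),
                ← ENNReal.ofReal_mul (by positivity), norm_smul, Real.norm_of_nonneg hs0.le,
                Real.mul_rpow hs0.le hx0.le, ← mul_assoc, ← Real.rpow_add hs0,
                Real.rpow_sub_one hx0.ne', div_mul_cancel₀ _ hx0.ne']
              simp
  have hmeasF : Measurable (uncurry fun (x : E) (s : ℝ) =>
      ENNReal.ofReal (s ^ (-a)) * G (s • x)) := by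
    refine Measurable.mul (by fun_prop) (hG.comp ?_)
    exact (continuous_snd.smul continuous_fst).measurable
  have hmeasI : Measurable fun s : ℝ => ENNReal.ofReal (s ^ (-a - d)) := by fun_prop
  calc ∫⁻ x, ENNReal.ofReal (‖x‖ ^ (a - 1)) * ‖g x‖ₑ ∂μ
      ≤ ∫⁻ x, (∫⁻ s in Ioi (1 : ℝ), ENNReal.ofReal (s ^ (-a)) * G (s • x)) ∂μ := by
        refine lintegral_mono_ae ?_
        filter_upwards [compl_mem_ae_iff.2 (measure_singleton (μ := μ) (0 : E))] with x hx
        exact hpt x hx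
    _ = ∫⁻ s in Ioi (1 : ℝ), ∫⁻ x, ENNReal.ofReal (s ^ (-a)) * G (s • x) ∂μ :=
        lintegral_lintegral_swap hmeasF.aemeasurable
    _ = ∫⁻ s in Ioi (1 : ℝ), ENNReal.ofReal (s ^ (-a - d)) * (∫⁻ x, G x ∂μ) := by
        refine setLIntegral_congr_fun measurableSet_Ioi fun s hs => ?_
        have hs0 : (0 : ℝ) < s := zero_lt_one.trans hs
        rw [lintegral_const_mul (f := fun x => G (s • x)) _ (hG.comp (measurable_const_smul s)),
          lintegral_comp_smul_of_pos μ hs0 hG, ← mul_assoc, ← ENNReal.ofReal_mul (by positivity),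
          ← Real.rpow_add hs0, sub_eq_add_neg]
    _ = ENNReal.ofReal (1 / (a + d - 1)) * ∫⁻ x, G x ∂μ := by
        have hlt : -a - d < -1 := by linarith
        rw [lintegral_mul_const _ hmeasI, ← ofReal_integral_eq_lintegral_ofReal
          (integrableOn_Ioi_rpow_of_lt hlt one_pos), integral_Ioi_rpow_of_lt hlt one_pos,
          Real.one_rpow]
        · congr 2
          rw [← neg_div_neg_eq]
          congr 1 <;> ring
        · filter_upwards [ae_restrict_mem measurableSet_Ioi] with s hs
          have hs0 : (0 : ℝ) < s := zero_lt_one.trans hs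
          positivity

end Hardy

section Grushin

variable {n m : ℕ} {α β : ℝ}
  {f : EuclideanSpace ℝ (Fin n) × EuclideanSpace ℝ (Fin m) → ℝ}

lemma norm_gradient_eq_norm_fderiv {F : Type*} [NormedAddCommGroup F] [InnerProductSpace ℝ F]
    [CompleteSpace F] (g : F → ℝ) (x : F) : ‖gradient g x‖ = ‖fderiv ℝ g x‖ :=
  (InnerProductSpace.toDual ℝ F).symm.norm_map _

lemma isClosedEmbedding_prodMk_left {E F : Type*} [NormedAddCommGroup E] [CompleteSpace E]
    [NormedAddCommGroup F] (y : F) : IsClosedEmbedding fun x : E => (x, y) :=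
  (Isometry.of_dist_eq fun a b => by simp [Prod.dist_eq]).isClosedEmbedding

lemma isClosedEmbedding_prodMk_right {E F : Type*} [NormedAddCommGroup E]
    [NormedAddCommGroup F] [CompleteSpace F] (x : E) : IsClosedEmbedding fun y : F => (x, y) :=
  (Isometry.of_dist_eq fun a b => by simp [Prod.dist_eq]).isClosedEmbedding

lemma gradLNorm_eq_fderiv (hf : Differentiable ℝ f)
    (ξ : EuclideanSpace ℝ (Fin n) × EuclideanSpace ℝ (Fin m)) :
    gradLNorm n m α β f ξ =
      √(‖ξ.1‖ ^ (2 * α) * ‖fderiv ℝ f ξ ∘L ContinuousLinearMap.inl ℝ _ _‖ ^ 2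
        + ‖ξ.1‖ ^ (2 * β) * ‖fderiv ℝ f ξ ∘L ContinuousLinearMap.inr ℝ _ _‖ ^ 2) := by
  have h1 : fderiv ℝ (fun x => f (x, ξ.2)) ξ.1 =
      fderiv ℝ f ξ ∘L ContinuousLinearMap.inl ℝ _ _ :=
    ((hf (ξ.1, ξ.2)).hasFDerivAt.comp ξ.1 (hasFDerivAt_prodMk_left ξ.1 ξ.2)).fderiv
  have h2 : fderiv ℝ (fun y => f (ξ.1, y)) ξ.2 =
      fderiv ℝ f ξ ∘L ContinuousLinearMap.inr ℝ _ _ :=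
    ((hf (ξ.1, ξ.2)).hasFDerivAt.comp ξ.2 (hasFDerivAt_prodMk_right ξ.1 ξ.2)).fderiv
  rw [gradLNorm, norm_gradient_eq_norm_fderiv, norm_gradient_eq_norm_fderiv, h1, h2]

lemma continuous_gradLNorm (hα : 0 ≤ α) (hβ : 0 ≤ β) (hf : ContDiff ℝ 1 f) :
    Continuous (gradLNorm n m α β f) := by
  have hd : Continuous (fderiv ℝ f) := hf.continuous_fderiv one_ne_zero
  rw [funext (gradLNorm_eq_fderiv (α := α) (β := β) (hf.differentiable one_ne_zero))]
  have h1 : Continuous fun ξ : EuclideanSpace ℝ (Fin n) × EuclideanSpace ℝ (Fin m) =>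
      ‖ξ.1‖ ^ (2 * α) := continuous_fst.norm.rpow_const fun _ => .inr (by positivity)
  have h2 : Continuous fun ξ : EuclideanSpace ℝ (Fin n) × EuclideanSpace ℝ (Fin m) =>
      ‖ξ.1‖ ^ (2 * β) := continuous_fst.norm.rpow_const fun _ => .inr (by positivity)
  fun_prop

lemma hasCompactSupport_gradLNorm (hf : ContDiff ℝ 1 f) (hc : HasCompactSupport f) :
    HasCompactSupport (gradLNorm n m α β f) := by
  refine (hc.fderiv (𝕜 := ℝ)).mono fun ξ hξ => ?_
  contrapose! hξ
  simp only [mem_support, not_not] at hξ ⊢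
  rw [gradLNorm_eq_fderiv (hf.differentiable one_ne_zero), hξ]
  simp

lemma rpow_mul_le_sqrt_add {r a g B : ℝ} (hr : 0 ≤ r) (hB : 0 ≤ B) :
    r ^ a * g ≤ √(r ^ (2 * a) * g ^ 2 + B) := by
  refine Real.le_sqrt_of_sq_le ?_
  rw [mul_pow, mul_comm 2 a, Real.rpow_mul hr, Real.rpow_two]
  linarith

lemma rpow_norm_mul_enorm_fderiv_fst_le (x : EuclideanSpace ℝ (Fin n))
    (y : EuclideanSpace ℝ (Fin m)) :
    ENNReal.ofReal (‖x‖ ^ α) * ‖fderiv ℝ (fun x => f (x, y)) x‖ₑ ≤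
      ENNReal.ofReal (gradLNorm n m α β f (x, y)) := by
  rw [← ofReal_norm, ← ENNReal.ofReal_mul (by positivity), ← norm_gradient_eq_norm_fderiv]
  exact ENNReal.ofReal_le_ofReal
    (rpow_mul_le_sqrt_add (norm_nonneg _) (by positivity))

lemma rpow_norm_mul_enorm_fderiv_snd_le (x : EuclideanSpace ℝ (Fin n))
    (y : EuclideanSpace ℝ (Fin m)) :
    ENNReal.ofReal (‖x‖ ^ β) * ‖fderiv ℝ (fun y => f (x, y)) y‖ₑ ≤
      ENNReal.ofReal (gradLNorm n m α β f (x, y)) := by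
  rw [← ofReal_norm, ← ENNReal.ofReal_mul (by positivity), ← norm_gradient_eq_norm_fderiv,
    gradLNorm, add_comm]
  exact ENNReal.ofReal_le_ofReal
    (rpow_mul_le_sqrt_add (norm_nonneg _) (by positivity))

/-- The point of `ℝⁿ × ℝᵐ` with the given `n + m` coordinates. -/
def ofSumCoords (n m : ℕ) (z : Fin n ⊕ Fin m → ℝ) :
    EuclideanSpace ℝ (Fin n) × EuclideanSpace ℝ (Fin m) :=
  (WithLp.toLp 2 fun i => z (.inl i), WithLp.toLp 2 fun j => z (.inr j))

lemma measurePreserving_ofSumCoords : MeasurePreserving (ofSumCoords n m) :=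
  ((PiLp.volume_preserving_toLp (Fin n)).prod (PiLp.volume_preserving_toLp (Fin m))).comp
    (volume_measurePreserving_sumPiEquivProdPi fun _ : Fin n ⊕ Fin m => ℝ)

lemma ofSumCoords_update_inl (z : Fin n ⊕ Fin m → ℝ) (i : Fin n) (t : ℝ) :
    ofSumCoords n m (update z (.inl i) t) =
      (WithLp.toLp 2 (update (fun i => z (.inl i)) i t), (ofSumCoords n m z).2) := by
  have h : (fun i' => update z (.inl i) t (.inl i')) = update (fun i => z (.inl i)) i t :=
    update_comp_eq_of_injective z Sum.inl_injective i t
  rw [ofSumCoords, h]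
  rfl

lemma ofSumCoords_update_inr (z : Fin n ⊕ Fin m → ℝ) (j : Fin m) (t : ℝ) :
    ofSumCoords n m (update z (.inr j) t) =
      ((ofSumCoords n m z).1, WithLp.toLp 2 (update (fun j => z (.inr j)) j t)) := by
  have h : (fun j' => update z (.inr j) t (.inr j')) = update (fun j => z (.inr j)) j t :=
    update_comp_eq_of_injective z Sum.inr_injective j t
  rw [ofSumCoords, h]
  rfl

lemma rpow_norm_mul_enorm_le_lintegral_gradLNorm_inl (hα : 0 ≤ α) (hf : ContDiff ℝ 1 f)
    (hc : HasCompactSupport f) (z : Fin n ⊕ Fin m → ℝ) (i : Fin n) :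
    ENNReal.ofReal (‖(ofSumCoords n m z).1‖ ^ α) * ‖f (ofSumCoords n m z)‖ₑ ≤
      ∫⁻ t, ENNReal.ofReal (gradLNorm n m α β f (ofSumCoords n m (update z (.inl i) t))) := by
  refine (EuclideanSpace.rpow_norm_mul_enorm_le_lintegral_update
    (g := fun x => f (x, (ofSumCoords n m z).2)) (hf.comp (contDiff_prodMk_left _))
    (hc.comp_isClosedEmbedding (isClosedEmbedding_prodMk_left _)) hα
    (fun i => z (.inl i)) i).trans (lintegral_mono fun t => ?_)
  rw [ofSumCoords_update_inl]
  exact rpow_norm_mul_enorm_fderiv_fst_le _ _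

lemma rpow_norm_mul_enorm_le_lintegral_gradLNorm_inr (hf : ContDiff ℝ 1 f)
    (hc : HasCompactSupport f) (z : Fin n ⊕ Fin m → ℝ) (j : Fin m) :
    ENNReal.ofReal (‖(ofSumCoords n m z).1‖ ^ β) * ‖f (ofSumCoords n m z)‖ₑ ≤
      ∫⁻ t, ENNReal.ofReal (gradLNorm n m α β f (ofSumCoords n m (update z (.inr j) t))) := by
  have h := EuclideanSpace.rpow_norm_mul_enorm_le_lintegral_update
    (g := fun y => f ((ofSumCoords n m z).1, y)) (hf.comp (contDiff_prodMk_right _))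
    (hc.comp_isClosedEmbedding (isClosedEmbedding_prodMk_right _)) le_rfl
    (fun j => z (.inr j)) j
  simp only [Real.rpow_zero, ENNReal.ofReal_one, one_mul] at h
  refine (mul_le_mul_right h _).trans ?_
  rw [← lintegral_const_mul' _ _ ENNReal.ofReal_ne_top]
  refine lintegral_mono fun t => ?_
  rw [ofSumCoords_update_inr]
  exact rpow_norm_mul_enorm_fderiv_snd_le _ _

/-- A weighted Gagliardo-Nirenberg inequality with the exponent of the topological dimension. -/
lemma lintegral_rpow_norm_mul_enorm_le_gradLNorm (hn : 1 ≤ n) (hm : 1 ≤ m) (hα : 0 ≤ α)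
    (hβ : 0 ≤ β) (hf : ContDiff ℝ 1 f) (hc : HasCompactSupport f) :
    ∫⁻ ξ, (ENNReal.ofReal (‖ξ.1‖ ^ (n * α + m * β)) * ‖f ξ‖ₑ ^ ((n : ℝ) + m)) ^
        (1 / ((n : ℝ) + m - 1)) ≤
      (∫⁻ ξ, ENNReal.ofReal (gradLNorm n m α β f ξ)) ^ (((n : ℝ) + m) / ((n : ℝ) + m - 1)) := by
  have hn' : (1 : ℝ) ≤ n := by exact_mod_cast hn
  have hm' : (1 : ℝ) ≤ m := by exact_mod_cast hm
  have hcard : (Fintype.card (Fin n ⊕ Fin m) : ℝ) = n + m := by simp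
  have hcont := hf.continuous
  have hG : Measurable fun ξ => ENNReal.ofReal (gradLNorm n m α β f ξ) :=
    (continuous_gradLNorm hα hβ hf).measurable.ennreal_ofReal
  have hL : Measurable fun ξ : EuclideanSpace ℝ (Fin n) × EuclideanSpace ℝ (Fin m) =>
      (ENNReal.ofReal (‖ξ.1‖ ^ (n * α + m * β)) * ‖f ξ‖ₑ ^ ((n : ℝ) + m)) ^
        (1 / ((n : ℝ) + m - 1)) := by
    fun_prop
  have hconj : Real.HolderConjugate (Fintype.card (Fin n ⊕ Fin m))
      (((n : ℝ) + m) / ((n : ℝ) + m - 1)) := by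
    rw [hcard]
    exact Real.HolderConjugate.conjExponent (by linarith)
  rw [← measurePreserving_ofSumCoords.lintegral_comp hL,
    ← measurePreserving_ofSumCoords.lintegral_comp hG]
  refine le_trans (lintegral_mono fun z => ?_) (lintegral_prod_lintegral_pow_le (fun _ => volume)
    hconj (hG.comp measurePreserving_ofSumCoords.measurable))
  rw [hcard]
  have hr : 0 ≤ ‖(ofSumCoords n m z).1‖ := norm_nonneg _
  calc _ = (∏ i : Fin n ⊕ Fin m, Sum.elim
          (fun _ => ENNReal.ofReal (‖(ofSumCoords n m z).1‖ ^ α) * ‖f (ofSumCoords n m z)‖ₑ)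
          (fun _ => ENNReal.ofReal (‖(ofSumCoords n m z).1‖ ^ β) * ‖f (ofSumCoords n m z)‖ₑ) i) ^
        (1 / ((n : ℝ) + m - 1)) := by
        congr 1
        rw [Fintype.prod_sum_type]
        simp only [Sum.elim_inl, Sum.elim_inr, Finset.prod_const, Finset.card_univ,
          Fintype.card_fin, mul_pow]
        rw [mul_mul_mul_comm, ← pow_add, ← ENNReal.ofReal_pow (by positivity),
          ← ENNReal.ofReal_pow (by positivity), ← ENNReal.ofReal_mul (by positivity),
          ← Real.rpow_mul_natCast hr, ← Real.rpow_mul_natCast hr,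
          ← Real.rpow_add_of_nonneg hr (by positivity) (by positivity), mul_comm α, mul_comm β]
        congr 1
        exact_mod_cast ENNReal.rpow_natCast _ (n + m)
    _ = ∏ i : Fin n ⊕ Fin m, Sum.elim
          (fun _ => ENNReal.ofReal (‖(ofSumCoords n m z).1‖ ^ α) * ‖f (ofSumCoords n m z)‖ₑ)
          (fun _ => ENNReal.ofReal (‖(ofSumCoords n m z).1‖ ^ β) * ‖f (ofSumCoords n m z)‖ₑ) i ^
        (1 / ((n : ℝ) + m - 1)) :=
        (ENNReal.prod_rpow_of_nonneg (one_div_nonneg.2 (by linarith))).symm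
    _ ≤ _ := by
        refine Finset.prod_le_prod' fun i _ => ENNReal.rpow_le_rpow ?_
          (one_div_nonneg.2 (by linarith))
        rcases i with i | j
        · exact rpow_norm_mul_enorm_le_lintegral_gradLNorm_inl hα hf hc z i
        · exact rpow_norm_mul_enorm_le_lintegral_gradLNorm_inr hf hc z j

/-- Hardy's inequality for the Grushin gradient. -/
lemma lintegral_hardy_le_gradLNorm (hn : 1 ≤ n) (hα : 0 < α) (hβ : 0 ≤ β) (hf : ContDiff ℝ 1 f)
    (hc : HasCompactSupport f) :
    ∫⁻ ξ, ENNReal.ofReal (‖ξ.1‖ ^ (α - 1)) * ‖f ξ‖ₑ ≤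
      ENNReal.ofReal (1 / (α + n - 1)) * ∫⁻ ξ, ENNReal.ofReal (gradLNorm n m α β f ξ) := by
  have hn' : (1 : ℝ) ≤ n := by exact_mod_cast hn
  have : Nontrivial (EuclideanSpace ℝ (Fin n)) :=
    Module.finrank_pos_iff (R := ℝ).1 (by simp; omega)
  have hcont := hf.continuous
  have hG : Measurable fun ξ => ENNReal.ofReal (gradLNorm n m α β f ξ) :=
    (continuous_gradLNorm hα.le hβ hf).measurable.ennreal_ofReal
  have hL : Measurable fun ξ : EuclideanSpace ℝ (Fin n) × EuclideanSpace ℝ (Fin m) =>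
      ENNReal.ofReal (‖ξ.1‖ ^ (α - 1)) * ‖f ξ‖ₑ := by
    fun_prop
  rw [Measure.volume_eq_prod, lintegral_prod_symm _ hL.aemeasurable,
    lintegral_prod_symm _ hG.aemeasurable, ← lintegral_const_mul' _ _ ENNReal.ofReal_ne_top]
  refine lintegral_mono fun y => ?_
  have h := HasCompactSupport.lintegral_rpow_norm_mul_enorm_le volume (a := α)
    (g := fun x => f (x, y))
    (hf.comp (contDiff_prodMk_left _))
    (hc.comp_isClosedEmbedding (isClosedEmbedding_prodMk_left _)) (by simp; linarith)
  rw [finrank_euclideanSpace_fin] at h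
  refine h.trans ?_
  gcongr with x
  exact rpow_norm_mul_enorm_fderiv_fst_le _ _

lemma lt_homDim (hn : 1 ≤ n) (hα : α ∈ Ioo (0 : ℝ) 1) (hβ : 0 ≤ β) :
    (n : ℝ) + m < homDim n m α β := by
  have hn' : (1 : ℝ) ≤ n := by exact_mod_cast hn
  have hm' : (0 : ℝ) ≤ m := by positivity
  rw [homDim, lt_div_iff₀ (by linarith [hα.2])]
  nlinarith [mul_pos (by linarith : (0 : ℝ) < n) hα.1, mul_nonneg hm' hβ]

/-- The pointwise identity behind the interpolation between the two weighted inequalities. -/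
lemma rpow_eq_interpolation {r v a N Q b : ℝ} (hr : 0 < r) (hv : 0 < v) (hN : N ≠ 1) (hQ : Q ≠ 1)
    (hb : b = (1 - a) * (Q - N)) :
    v ^ (Q / (Q - 1)) = ((r ^ b * v ^ N) ^ (1 / (N - 1))) ^ ((N - 1) / (Q - 1)) *
      (r ^ (a - 1) * v) ^ ((Q - N) / (Q - 1)) := by
  have hN' : N - 1 ≠ 0 := sub_ne_zero.2 hN
  have hQ' : Q - 1 ≠ 0 := sub_ne_zero.2 hQ
  rw [← Real.rpow_mul (by positivity), Real.mul_rpow (by positivity) (by positivity),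
    Real.mul_rpow (by positivity) hv.le, ← Real.rpow_mul hr.le, ← Real.rpow_mul hv.le,
    ← Real.rpow_mul hr.le, mul_mul_mul_comm, ← Real.rpow_add hr, ← Real.rpow_add hv]
  have h1 : b * (1 / (N - 1) * ((N - 1) / (Q - 1))) + (a - 1) * ((Q - N) / (Q - 1)) = 0 := by
    rw [hb]; field_simp; ring
  have h2 : N * (1 / (N - 1) * ((N - 1) / (Q - 1))) + (Q - N) / (Q - 1) = Q / (Q - 1) := by
    field_simp; ring
  rw [h1, h2, Real.rpow_zero, one_mul]

lemma lintegral_enorm_rpow_homDim_le (hn : 1 ≤ n) (hm : 1 ≤ m) (hα : α ∈ Ioo (0 : ℝ) 1)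
    (hβ : 0 ≤ β) (hf : ContDiff ℝ 1 f) (hc : HasCompactSupport f) :
    ∫⁻ ξ, ‖f ξ‖ₑ ^ (homDim n m α β / (homDim n m α β - 1)) ≤
      ENNReal.ofReal (1 / (α + n - 1)) ^ ((homDim n m α β - (n + m)) / (homDim n m α β - 1)) *
        (∫⁻ ξ, ENNReal.ofReal (gradLNorm n m α β f ξ)) ^
          (homDim n m α β / (homDim n m α β - 1)) := by
  have hn' : (1 : ℝ) ≤ n := by exact_mod_cast hn
  have hm' : (1 : ℝ) ≤ m := by exact_mod_cast hm
  have hα' : 1 - α ≠ 0 := by linarith [hα.2]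
  have hNQ := lt_homDim (m := m) hn hα hβ
  have hb : n * α + m * β = (1 - α) * (homDim n m α β - (n + m)) := by
    rw [homDim]; field_simp; ring
  have hI := lintegral_rpow_norm_mul_enorm_le_gradLNorm hn hm hα.1.le hβ hf hc
  have hH := lintegral_hardy_le_gradLNorm hn hα.1 hβ hf hc
  rw [hb] at hI
  generalize homDim n m α β = Q at *
  set N : ℝ := (n : ℝ) + m
  set I := ∫⁻ ξ, ENNReal.ofReal (gradLNorm n m α β f ξ)
  have hN1 : 0 < N - 1 := by simp only [N]; linarith
  have hQ1 : 0 < Q - 1 := by linarith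
  have hθ : 0 ≤ (N - 1) / (Q - 1) := by positivity
  have hθ' : 0 ≤ (Q - N) / (Q - 1) := div_nonneg (by linarith) hQ1.le
  have : Nontrivial (EuclideanSpace ℝ (Fin n)) :=
    Module.finrank_pos_iff (R := ℝ).1 (by simp; omega)
  have hcont := hf.continuous
  have hae : ∀ᵐ ξ : EuclideanSpace ℝ (Fin n) × EuclideanSpace ℝ (Fin m), ξ.1 ≠ 0 :=
    Measure.quasiMeasurePreserving_fst.ae
      (compl_mem_ae_iff.2 (measure_singleton (μ := volume) (0 : EuclideanSpace ℝ (Fin n))))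
  calc ∫⁻ ξ, ‖f ξ‖ₑ ^ (Q / (Q - 1))
      ≤ ∫⁻ ξ, ((ENNReal.ofReal (‖ξ.1‖ ^ ((1 - α) * (Q - N))) * ‖f ξ‖ₑ ^ N) ^
          (1 / (N - 1))) ^ ((N - 1) / (Q - 1)) *
          (ENNReal.ofReal (‖ξ.1‖ ^ (α - 1)) * ‖f ξ‖ₑ) ^ ((Q - N) / (Q - 1)) := by
        refine lintegral_mono_ae (hae.mono fun ξ hξ => ?_)
        have hr : 0 < ‖ξ.1‖ := norm_pos_iff.2 hξ
        rcases eq_or_ne (f ξ) 0 with h0 | h0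
        · rw [h0, enorm_zero, ENNReal.zero_rpow_of_pos (div_pos (by linarith) hQ1)]
          exact zero_le
        · have hv : 0 < ‖f ξ‖ := norm_pos_iff.2 h0
          rw [← ofReal_norm (f ξ), ENNReal.ofReal_rpow_of_pos hv, ENNReal.ofReal_rpow_of_pos hv,
            ← ENNReal.ofReal_mul (by positivity), ← ENNReal.ofReal_mul (by positivity),
            ENNReal.ofReal_rpow_of_pos (by positivity), ENNReal.ofReal_rpow_of_pos (by positivity),
            ENNReal.ofReal_rpow_of_pos (by positivity), ← ENNReal.ofReal_mul (by positivity),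
            rpow_eq_interpolation hr hv (sub_ne_zero.1 hN1.ne') (sub_ne_zero.1 hQ1.ne') rfl]
    _ ≤ (I ^ (N / (N - 1))) ^ ((N - 1) / (Q - 1)) *
          (ENNReal.ofReal (1 / (α + n - 1)) * I) ^ ((Q - N) / (Q - 1)) := by
        refine (ENNReal.lintegral_mul_norm_pow_le (by fun_prop) (by fun_prop) hθ hθ' ?_).trans ?_
        · field_simp; ring
        · gcongr
    _ = ENNReal.ofReal (1 / (α + n - 1)) ^ ((Q - N) / (Q - 1)) * I ^ (Q / (Q - 1)) := by
        rw [ENNReal.mul_rpow_of_nonneg _ _ hθ', ← ENNReal.rpow_mul, mul_left_comm,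
          ← ENNReal.rpow_add_of_nonneg _ _ (by positivity) hθ']
        congr 2
        field_simp; ring

end Grushin

/-- The Sobolev inequality `(S_Q^1)`, equivalent to the isoperimetric
inequality on the Grushin space. -/
theorem sobolev_ineq_S1 (n m : ℕ) (hn : 1 ≤ n) (hm : 1 ≤ m) (α β : ℝ)
    (hα : α ∈ Set.Ioo (0 : ℝ) 1) (hβ : 0 ≤ β) :
    ∃ C : ℝ, 0 < C ∧
      ∀ f : EuclideanSpace ℝ (Fin n) × EuclideanSpace ℝ (Fin m) → ℝ,
        ContDiff ℝ (⊤ : ℕ∞) f → HasCompactSupport f →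
        (∫ ξ, |f ξ| ^ (homDim n m α β / (homDim n m α β - 1))) ^
            ((homDim n m α β - 1) / homDim n m α β)
          ≤ C * ∫ ξ, gradLNorm n m α β f ξ := by
  have hn' : (1 : ℝ) ≤ n := by exact_mod_cast hn
  have hm' : (1 : ℝ) ≤ m := by exact_mod_cast hm
  have hNQ := lt_homDim (m := m) hn hα hβ
  have hQ1 : 0 < homDim n m α β - 1 := by linarith
  have hc0 : 0 < 1 / (α + n - 1) := one_div_pos.2 (by linarith [hα.1])
  set Q := homDim n m α β with hQ
  refine ⟨((1 / (α + n - 1)) ^ ((Q - (n + m)) / (Q - 1))) ^ ((Q - 1) / Q), by positivity,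
    fun f hf hc => ?_⟩
  have hf1 : ContDiff ℝ 1 f := hf.of_le (by exact_mod_cast le_top)
  have hcont := hf1.continuous
  have h := lintegral_enorm_rpow_homDim_le hn hm hα hβ hf1 hc
  rw [← hQ] at h
  have hGnn : ∀ ξ, 0 ≤ gradLNorm n m α β f ξ := fun ξ => Real.sqrt_nonneg _
  have hGcont := continuous_gradLNorm hα.1.le hβ hf1
  have hGint : Integrable (gradLNorm n m α β f) :=
    hGcont.integrable_of_hasCompactSupport (hasCompactSupport_gradLNorm hf1 hc)
  have hJ : 0 ≤ ∫ ξ, gradLNorm n m α β f ξ := integral_nonneg hGnn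
  have hp : 0 < Q / (Q - 1) := div_pos (by linarith) hQ1
  rw [← ofReal_integral_eq_lintegral_ofReal hGint (ae_of_all _ hGnn),
    ENNReal.ofReal_rpow_of_pos hc0, ENNReal.ofReal_rpow_of_nonneg hJ hp.le,
    ← ENNReal.ofReal_mul (by positivity)] at h
  have hL : ∫ ξ, |f ξ| ^ (Q / (Q - 1)) ≤
      (1 / (α + n - 1)) ^ ((Q - (n + m)) / (Q - 1)) *
        (∫ ξ, gradLNorm n m α β f ξ) ^ (Q / (Q - 1)) := by
    rw [integral_eq_lintegral_of_nonneg_ae (ae_of_all _ fun ξ => by positivity)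
      (hcont.abs.rpow_const fun _ => .inr hp.le).aestronglyMeasurable]
    refine ENNReal.toReal_le_of_le_ofReal (by positivity) (le_trans (le_of_eq ?_) h)
    refine lintegral_congr fun ξ => ?_
    rw [← ofReal_norm, Real.norm_eq_abs, ENNReal.ofReal_rpow_of_nonneg (abs_nonneg _) hp.le]
  calc _ ≤ ((1 / (α + n - 1)) ^ ((Q - (n + m)) / (Q - 1)) *
        (∫ ξ, gradLNorm n m α β f ξ) ^ (Q / (Q - 1))) ^ ((Q - 1) / Q) := by
        refine Real.rpow_le_rpow (integral_nonneg fun ξ => by positivity) hL ?_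
        exact div_nonneg hQ1.le (by linarith)
    _ = _ := by
        rw [Real.mul_rpow (by positivity) (by positivity), ← Real.rpow_mul hJ,
          div_mul_div_cancel₀ hQ1.ne', div_self (by linarith), Real.rpow_one]
end

section
/- Let n, m ≥ 1, α ∈ (0,1), β ≥ 0. There exist constants C, C' > 0 depending only on n, m, α, β such that for every smooth function f on (ℝⁿ \ {0}) × ℝᵐ and every point (x,y) with x ≠ 0, the curvature–dimension inequality Γ₂(f)(x,y) ≥ −(C / |x|^{2(1−α)}) Γ(f)(x,y) + C' (𝓛 f(x,y))² holds. -/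
open MeasureTheory

/-- Directional (partial) derivative of `f` at `ξ` in direction `v`. -/
noncomputable def pderiv' {n m : ℕ}
    (v : EuclideanSpace ℝ (Fin n) × EuclideanSpace ℝ (Fin m))
    (f : EuclideanSpace ℝ (Fin n) × EuclideanSpace ℝ (Fin m) → ℝ)
    (ξ : EuclideanSpace ℝ (Fin n) × EuclideanSpace ℝ (Fin m)) : ℝ :=
  fderiv ℝ f ξ v

/-- The `i`-th coordinate direction in the `x`-variables. -/
noncomputable def eX (n m : ℕ) (i : Fin n) :
    EuclideanSpace ℝ (Fin n) × EuclideanSpace ℝ (Fin m) :=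
  (EuclideanSpace.single i (1 : ℝ), 0)

/-- The `μ`-th coordinate direction in the `y`-variables. -/
noncomputable def eY (n m : ℕ) (μ : Fin m) :
    EuclideanSpace ℝ (Fin n) × EuclideanSpace ℝ (Fin m) :=
  (0, EuclideanSpace.single μ (1 : ℝ))

/-- The (non-positive) Grushin diffusion operator
`𝓛 f = |x|^{2α} Δ_x f + ∇(|x|^{2α}) · ∇_x f + |x|^{2β} Δ_y f`,
where `∇(|x|^{2α}) = 2α |x|^{2α−2} x`. -/
noncomputable def Lop (n m : ℕ) (α β : ℝ)
    (f : EuclideanSpace ℝ (Fin n) × EuclideanSpace ℝ (Fin m) → ℝ)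
    (ξ : EuclideanSpace ℝ (Fin n) × EuclideanSpace ℝ (Fin m)) : ℝ :=
  ‖ξ.1‖ ^ (2 * α) * (∑ i, pderiv' (eX n m i) (pderiv' (eX n m i) f) ξ)
    + 2 * α * ‖ξ.1‖ ^ (2 * α - 2) * (∑ i, ξ.1 i * pderiv' (eX n m i) f ξ)
    + ‖ξ.1‖ ^ (2 * β) * (∑ μ, pderiv' (eY n m μ) (pderiv' (eY n m μ) f) ξ)

/-- The carré du champ `Γ(f,g) = ½(𝓛(fg) − f 𝓛g − g 𝓛f)`. -/
noncomputable def carre (n m : ℕ) (α β : ℝ)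
    (f g : EuclideanSpace ℝ (Fin n) × EuclideanSpace ℝ (Fin m) → ℝ)
    (ξ : EuclideanSpace ℝ (Fin n) × EuclideanSpace ℝ (Fin m)) : ℝ :=
  (Lop n m α β (fun η => f η * g η) ξ - f ξ * Lop n m α β g ξ
    - g ξ * Lop n m α β f ξ) / 2

/-- The second carré du champ `Γ₂(f) = ½(𝓛 Γ(f) − 2 Γ(f, 𝓛f))`. -/
noncomputable def carre2 (n m : ℕ) (α β : ℝ)
    (f : EuclideanSpace ℝ (Fin n) × EuclideanSpace ℝ (Fin m) → ℝ)
    (ξ : EuclideanSpace ℝ (Fin n) × EuclideanSpace ℝ (Fin m)) : ℝ :=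
  (Lop n m α β (carre n m α β f f) ξ - 2 * carre n m α β f (Lop n m α β f) ξ) / 2

open scoped ContDiff

section Bochner

variable {R ι : Type*} [CommRing R] [Algebra ℝ R] [Fintype ι]

/-- The divergence-form operator `f ↦ ∑ D_A (w_A D_A f)` for a family of derivations `D`. -/
def diffusion (D : ι → Derivation ℝ R R) (w : ι → R) (f : R) : R :=
  ∑ A, (w A * D A (D A f) + D A (w A) * D A f)

theorem diffusion_mul (D : ι → Derivation ℝ R R) (w : ι → R) (f g : R) :
    diffusion D w (f * g) =
      f * diffusion D w g + g * diffusion D w f + 2 * ∑ A, w A * (D A f * D A g) := by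
  simp only [diffusion, Finset.mul_sum, ← Finset.sum_add_distrib]
  refine Finset.sum_congr rfl fun A _ => ?_
  simp only [Derivation.leibniz, map_add, smul_eq_mul]
  ring

/-- Bochner-type formula for a divergence-form operator built from commuting derivations. -/
theorem diffusion_bochner (D : ι → Derivation ℝ R R)
    (hD : ∀ A B f, D A (D B f) = D B (D A f)) (w : ι → R) (f : R) :
    diffusion D w (∑ B, w B * (D B f * D B f))
        - 2 * ∑ B, w B * (D B f * D B (diffusion D w f)) =
      ∑ B, diffusion D w (w B) * (D B f) ^ 2
        + 2 * ∑ A, ∑ B, w A * w B * (D A (D B f)) ^ 2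
        + 4 * ∑ A, ∑ B, w A * D A (w B) * D B f * D A (D B f)
        - 2 * ∑ A, ∑ B, w B * D B f * D B (w A) * D A (D A f)
        - 2 * ∑ A, ∑ B, w B * D B f * D B (D A (w A)) * D A f := by
  have h1 : ∑ B, w B * (D B f * D B (diffusion D w f)) =
      ∑ A, ∑ B, w B * (D B f * D B (w A * D A (D A f) + D A (w A) * D A f)) := by
    rw [Finset.sum_comm]
    simp only [diffusion, map_sum, Finset.mul_sum]
  have h2 : ∑ B, diffusion D w (w B) * (D B f) ^ 2 =
      ∑ A, ∑ B, (w A * D A (D A (w B)) + D A (w A) * D A (w B)) * (D B f) ^ 2 := by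
    rw [Finset.sum_comm]
    simp only [diffusion, Finset.sum_mul]
  rw [h1, h2]
  simp only [diffusion, map_sum, Finset.mul_sum, ← Finset.sum_add_distrib,
    ← Finset.sum_sub_distrib]
  refine Finset.sum_congr rfl fun A _ => Finset.sum_congr rfl fun B _ => ?_
  have h3 : D B (D A (D A f)) = D A (D A (D B f)) := by rw [hD B A, hD B A]
  simp only [Derivation.leibniz, map_add, smul_eq_mul, h3, hD B A f]
  ring

theorem map_diffusion_bochner {n m : ℕ} (D : Fin n ⊕ Fin m → Derivation ℝ R R)
    (hD : ∀ A B f, D A (D B f) = D B (D A f)) (w : Fin n ⊕ Fin m → R) (e : R →ₐ[ℝ] ℝ)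
    {x : Fin n → ℝ} {a b k α β lX lY : ℝ}
    (hwX : ∀ i, e (w (Sum.inl i)) = a) (hwY : ∀ μ, e (w (Sum.inr μ)) = b)
    (hdX : ∀ i j, e (D (Sum.inl i) (w (Sum.inl j))) = 2 * α * a * k * x i)
    (hdY : ∀ i μ, e (D (Sum.inl i) (w (Sum.inr μ))) = 2 * β * b * k * x i)
    (hd0 : ∀ μ A, D (Sum.inr μ) (w A) = 0)
    (hdd : ∀ i j, e (D (Sum.inl j) (D (Sum.inl i) (w (Sum.inl i)))) =
      2 * α * a * k * (if j = i then 1 else 0) + 2 * α * (2 * α - 2) * a * k ^ 2 * (x i * x j))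
    (hLX : ∀ i, e (diffusion D w (w (Sum.inl i))) = lX)
    (hLY : ∀ μ, e (diffusion D w (w (Sum.inr μ))) = lY) (f : R) :
    e (diffusion D w (∑ B, w B * (D B f * D B f))
        - 2 * ∑ B, w B * (D B f * D B (diffusion D w f))) / 2 =
      lX / 2 * ∑ i, e (D (Sum.inl i) f) ^ 2 + lY / 2 * ∑ μ, e (D (Sum.inr μ) f) ^ 2
      + a ^ 2 * ∑ i, ∑ j, e (D (Sum.inl i) (D (Sum.inl j) f)) ^ 2
      + 2 * a * b * ∑ i, ∑ μ, e (D (Sum.inl i) (D (Sum.inr μ) f)) ^ 2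
      + b ^ 2 * ∑ μ, ∑ ν, e (D (Sum.inr μ) (D (Sum.inr ν) f)) ^ 2
      + 4 * α * a ^ 2 * k * ∑ i, ∑ j,
          x i * e (D (Sum.inl j) f) * e (D (Sum.inl i) (D (Sum.inl j) f))
      + 4 * β * a * b * k * ∑ i, ∑ μ,
          x i * e (D (Sum.inr μ) f) * e (D (Sum.inl i) (D (Sum.inr μ) f))
      - 2 * α * a ^ 2 * k * (∑ j, x j * e (D (Sum.inl j) f)) *
          ∑ i, e (D (Sum.inl i) (D (Sum.inl i) f))
      - 2 * β * a * b * k * (∑ j, x j * e (D (Sum.inl j) f)) *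
          ∑ μ, e (D (Sum.inr μ) (D (Sum.inr μ) f))
      - 2 * α * a ^ 2 * k * ∑ i, e (D (Sum.inl i) f) ^ 2
      - 2 * α * (2 * α - 2) * a ^ 2 * k ^ 2 * (∑ j, x j * e (D (Sum.inl j) f)) ^ 2 := by
  have hd0' : ∀ μ A B, D (Sum.inr μ) (D B (w A)) = 0 := fun μ A B => by
    rw [hD, hd0, map_zero]
  rw [diffusion_bochner D hD]
  simp only [Fintype.sum_sum_type, map_add, map_sub, map_sum, map_mul, map_pow, map_ofNat, hwX,
    hwY, hdX, hdY, hd0, hd0', hdd, hLX, hLY, map_zero, zero_mul, mul_zero, add_zero,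
    Finset.sum_const_zero, Finset.sum_add_distrib]
  have hY : ∑ μ, ∑ i, b * a * e (D (Sum.inr μ) (D (Sum.inl i) f)) ^ 2 =
      ∑ i, ∑ μ, a * b * e (D (Sum.inl i) (D (Sum.inr μ) f)) ^ 2 := by
    rw [Finset.sum_comm]
    refine Finset.sum_congr rfl fun i _ => Finset.sum_congr rfl fun μ _ => ?_
    rw [hD, mul_comm b a]
  have hdiag : ∑ i, ∑ j, a * e (D (Sum.inl j) f) * (2 * α * a * k * (if j = i then 1 else 0) +
      2 * α * (2 * α - 2) * a * k ^ 2 * (x i * x j)) * e (D (Sum.inl i) f) =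
      2 * α * a ^ 2 * k * ∑ i, e (D (Sum.inl i) f) ^ 2
      + 2 * α * (2 * α - 2) * a ^ 2 * k ^ 2 * (∑ j, x j * e (D (Sum.inl j) f)) ^ 2 := by
    have h1 : ∀ i j, a * e (D (Sum.inl j) f) * (2 * α * a * k * (if j = i then 1 else 0) +
        2 * α * (2 * α - 2) * a * k ^ 2 * (x i * x j)) * e (D (Sum.inl i) f) =
        (if j = i then 2 * α * a ^ 2 * k * e (D (Sum.inl i) f) ^ 2 else 0) +
        2 * α * (2 * α - 2) * a ^ 2 * k ^ 2 *
          ((x i * e (D (Sum.inl i) f)) * (x j * e (D (Sum.inl j) f))) := fun i j => by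
      split_ifs with h
      · subst h
        ring
      · ring
    rw [sq (∑ j, x j * _), Finset.sum_mul_sum]
    simp only [h1, Finset.sum_add_distrib, Finset.sum_ite_eq', Finset.mem_univ, if_true,
      Finset.mul_sum]
  have hX : ∑ i, ∑ j, a * e (D (Sum.inl j) f) * (2 * α * a * k * x j) *
        e (D (Sum.inl i) (D (Sum.inl i) f)) =
      2 * α * a ^ 2 * k * (∑ j, x j * e (D (Sum.inl j) f)) *
          ∑ i, e (D (Sum.inl i) (D (Sum.inl i) f)) := by
    rw [Finset.sum_comm, mul_assoc (_ * k), Finset.sum_mul_sum]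
    simp only [Finset.mul_sum]
    refine Finset.sum_congr rfl fun i _ => Finset.sum_congr rfl fun μ _ => ?_
    ring
  have hZ : ∑ μ, ∑ j, a * e (D (Sum.inl j) f) * (2 * β * b * k * x j) *
        e (D (Sum.inr μ) (D (Sum.inr μ) f)) =
      2 * β * a * b * k * (∑ j, x j * e (D (Sum.inl j) f)) *
          ∑ μ, e (D (Sum.inr μ) (D (Sum.inr μ) f)) := by
    rw [Finset.sum_comm, mul_assoc (_ * k), Finset.sum_mul_sum]
    simp only [Finset.mul_sum]
    refine Finset.sum_congr rfl fun i _ => Finset.sum_congr rfl fun μ _ => ?_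
    ring
  have hXX : ∑ i, ∑ j, a * (2 * α * a * k * x i) * e (D (Sum.inl j) f) *
        e (D (Sum.inl i) (D (Sum.inl j) f)) =
      2 * α * a ^ 2 * k * ∑ i, ∑ j,
          x i * e (D (Sum.inl j) f) * e (D (Sum.inl i) (D (Sum.inl j) f)) := by
    simp only [Finset.mul_sum]
    refine Finset.sum_congr rfl fun i _ => Finset.sum_congr rfl fun μ _ => ?_
    ring
  have hXY : ∑ i, ∑ μ, a * (2 * β * b * k * x i) * e (D (Sum.inr μ) f) *
        e (D (Sum.inl i) (D (Sum.inr μ) f)) =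
      2 * β * a * b * k * ∑ i, ∑ μ,
          x i * e (D (Sum.inr μ) f) * e (D (Sum.inl i) (D (Sum.inr μ) f)) := by
    simp only [Finset.mul_sum]
    refine Finset.sum_congr rfl fun i _ => Finset.sum_congr rfl fun μ _ => ?_
    ring
  rw [hY, hdiag, hX, hZ, hXX, hXY]
  simp only [← Finset.mul_sum]
  ring

end Bochner

section SmoothOn

variable {E : Type*} [NormedAddCommGroup E] [NormedSpace ℝ E]

/-- The algebra of real functions that are smooth on `U`. -/
def smoothOn (U : Set E) : Subalgebra ℝ (E → ℝ) where
  carrier := {f | ContDiffOn ℝ ∞ f U}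
  mul_mem' := fun hf hg => ContDiffOn.mul hf hg
  add_mem' := fun hf hg => ContDiffOn.add hf hg
  algebraMap_mem' := fun _ => contDiffOn_const

/-- Evaluation at a point. -/
def evalAt (U : Set E) (ξ : E) : smoothOn U →ₐ[ℝ] ℝ :=
  (Pi.evalAlgHom ℝ (fun _ : E => ℝ) ξ).comp (smoothOn U).val

theorem evalAt_apply {U : Set E} (ξ : E) (f : smoothOn U) : evalAt U ξ f = f.1 ξ := rfl

theorem differentiableAt_of_mem_smoothOn {U : Set E} (hU : IsOpen U) (f : smoothOn U) {ξ : E}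
    (hξ : ξ ∈ U) : DifferentiableAt ℝ f.1 ξ :=
  (f.2.contDiffAt (hU.mem_nhds hξ)).differentiableAt (by simp)

open Classical in
/-- Differentiation in direction `v` on `U`, extended by zero. -/
noncomputable def dirDeriv (U : Set E) (hU : IsOpen U) (v : E) :
    Derivation ℝ (smoothOn U) (smoothOn U) :=
  Derivation.mk'
    { toFun := fun f => ⟨fun ξ => if ξ ∈ U then fderiv ℝ f.1 ξ v else 0, by
        have h : ContDiffOn ℝ ∞ (fun ξ => fderiv ℝ f.1 ξ v) U :=
          (f.2.fderiv_of_isOpen hU (by simp)).clm_apply contDiffOn_const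
        exact h.congr fun ξ hξ => if_pos hξ⟩
      map_add' := fun f g => by
        refine Subtype.ext (funext fun ξ => ?_)
        by_cases hξ : ξ ∈ U
        · have := fderiv_add (differentiableAt_of_mem_smoothOn hU f hξ)
            (differentiableAt_of_mem_smoothOn hU g hξ)
          simp [hξ, this]
        · simp [hξ]
      map_smul' := fun c f => by
        refine Subtype.ext (funext fun ξ => ?_)
        by_cases hξ : ξ ∈ U
        · have := fderiv_const_smul (differentiableAt_of_mem_smoothOn hU f hξ) c
          simp [hξ, this]
        · simp [hξ] }
    (fun f g => by
      refine Subtype.ext (funext fun ξ => ?_)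
      by_cases hξ : ξ ∈ U
      · have := fderiv_mul (differentiableAt_of_mem_smoothOn hU f hξ)
          (differentiableAt_of_mem_smoothOn hU g hξ)
        simp [hξ, this]
      · simp [hξ])

theorem evalAt_dirDeriv {U : Set E} (hU : IsOpen U) (v : E) (f : smoothOn U) {ξ : E}
    (hξ : ξ ∈ U) : evalAt U ξ (dirDeriv U hU v f) = fderiv ℝ f.1 ξ v := by
  simp [evalAt_apply, dirDeriv, hξ]

theorem dirDeriv_apply_of_notMem {U : Set E} (hU : IsOpen U) (v : E) (f : smoothOn U) {ξ : E}
    (hξ : ξ ∉ U) : (dirDeriv U hU v f).1 ξ = 0 := by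
  simp [dirDeriv, hξ]

theorem fderiv_apply_eq_evalAt_dirDeriv {U : Set E} (hU : IsOpen U) (v : E) {g : E → ℝ}
    (f : smoothOn U) (h : ∀ ξ ∈ U, g ξ = evalAt U ξ f) {ξ : E} (hξ : ξ ∈ U) :
    fderiv ℝ g ξ v = evalAt U ξ (dirDeriv U hU v f) := by
  rw [evalAt_dirDeriv hU v f hξ]
  have : g =ᶠ[nhds ξ] f.1 := Filter.eventuallyEq_of_mem (hU.mem_nhds hξ) h
  rw [this.fderiv_eq]

theorem dirDeriv_comm {U : Set E} (hU : IsOpen U) (v w : E) (f : smoothOn U) :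
    dirDeriv U hU v (dirDeriv U hU w f) = dirDeriv U hU w (dirDeriv U hU v f) := by
  refine Subtype.ext (funext fun ξ => ?_)
  by_cases hξ : ξ ∈ U
  · have hd : DifferentiableAt ℝ (fderiv ℝ f.1) ξ :=
      ((f.2.fderiv_of_isOpen hU (m := ∞) (by simp)).contDiffAt
        (hU.mem_nhds hξ)).differentiableAt (by simp)
    have key : ∀ v w : E, (dirDeriv U hU v (dirDeriv U hU w f)).1 ξ =
        fderiv ℝ (fderiv ℝ f.1) ξ v w := fun v w => by
      have h := fderiv_apply_eq_evalAt_dirDeriv hU v (g := fun η => fderiv ℝ f.1 η w)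
        (dirDeriv U hU w f) (fun η hη => (evalAt_dirDeriv hU w f hη).symm) hξ
      rw [evalAt_apply] at h
      rw [← h, fderiv_clm_apply hd (differentiableAt_const _)]
      simp
    have hs : IsSymmSndFDerivAt ℝ f.1 ξ :=
      (f.2.contDiffAt (hU.mem_nhds hξ)).isSymmSndFDerivAt (by
        rw [minSmoothness_of_isRCLikeNormedField]
        exact WithTop.coe_le_coe.2 (le_top : (2 : ℕ∞) ≤ ⊤))
    rw [key, key, hs.eq]
  · rw [dirDeriv_apply_of_notMem hU _ _ hξ, dirDeriv_apply_of_notMem hU _ _ hξ]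

end SmoothOn

section Grushin

variable (n m : ℕ)

/-- The domain `(ℝⁿ \ {0}) × ℝᵐ`. -/
def grushinDomain : Set (EuclideanSpace ℝ (Fin n) × EuclideanSpace ℝ (Fin m)) := {ξ | ξ.1 ≠ 0}

theorem isOpen_grushinDomain : IsOpen (grushinDomain n m) :=
  isOpen_ne.preimage continuous_fst

/-- The coordinate derivations on smooth functions on the domain. -/
noncomputable def coordDeriv (A : Fin n ⊕ Fin m) :
    Derivation ℝ (smoothOn (grushinDomain n m)) (smoothOn (grushinDomain n m)) :=
  dirDeriv _ (isOpen_grushinDomain n m) (Sum.elim (eX n m) (eY n m) A)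

open Classical in
/-- The function `|x| ^ p` on the domain, extended by zero. -/
noncomputable def normPow (p : ℝ) : smoothOn (grushinDomain n m) :=
  ⟨fun ξ => if ξ ∈ grushinDomain n m then ‖ξ.1‖ ^ p else 0, by
    have h : ContDiffOn ℝ ∞ (fun ξ => ‖ξ.1‖ ^ p) (grushinDomain n m) := fun ξ hξ =>
      ((contDiffAt_fst.norm ℝ hξ).rpow_const_of_ne (norm_ne_zero_iff.2 hξ)).contDiffWithinAt
    exact h.congr fun ξ hξ => if_pos hξ⟩

/-- The coordinate function `x_i`. -/
noncomputable def coordX (i : Fin n) : smoothOn (grushinDomain n m) :=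
  ⟨fun ξ => ξ.1 i, by
    have : ContDiff ℝ ∞ (fun ξ : EuclideanSpace ℝ (Fin n) × EuclideanSpace ℝ (Fin m) => ξ.1 i) := by
      fun_prop
    exact this.contDiffOn⟩

/-- The weights of the Grushin operator. -/
noncomputable def grushinWeight (α β : ℝ) : Fin n ⊕ Fin m → smoothOn (grushinDomain n m) :=
  Sum.elim (fun _ => normPow n m (2 * α)) (fun _ => normPow n m (2 * β))

variable {n m}

theorem evalAt_normPow (p : ℝ) {ξ} (hξ : ξ ∈ grushinDomain n m) :
    evalAt _ ξ (normPow n m p) = ‖ξ.1‖ ^ p := by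
  simp [evalAt_apply, normPow, hξ]

theorem evalAt_coordX (i : Fin n) (ξ) : evalAt _ ξ (coordX n m i) = ξ.1 i := rfl

theorem fderiv_norm_fst_rpow (p : ℝ) {ξ} (hξ : ξ ∈ grushinDomain n m)
    (v : EuclideanSpace ℝ (Fin n) × EuclideanSpace ℝ (Fin m)) :
    fderiv ℝ (fun ξ : EuclideanSpace ℝ (Fin n) × EuclideanSpace ℝ (Fin m) => ‖ξ.1‖ ^ p) ξ v =
      p * ‖ξ.1‖ ^ (p - 2) * inner ℝ ξ.1 v.1 := by
  have hpos : 0 < ‖ξ.1‖ := norm_pos_iff.2 hξ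
  have e : (fun ξ : EuclideanSpace ℝ (Fin n) × EuclideanSpace ℝ (Fin m) => ‖ξ.1‖ ^ p) =
      fun ξ => (‖ξ.1‖ ^ 2) ^ (p / 2) := by
    funext η
    rw [← Real.rpow_natCast, ← Real.rpow_mul (norm_nonneg _)]
    congr 1
    push_cast
    ring
  have h := ((hasFDerivAt_fst (𝕜 := ℝ) (p := ξ)).norm_sq).rpow_const (p := p / 2)
    (Or.inl (pow_pos hpos 2).ne')
  rw [e, h.fderiv]
  have e2 : (‖ξ.1‖ ^ 2) ^ (p / 2 - 1) = ‖ξ.1‖ ^ (p - 2) := by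
    rw [← Real.rpow_natCast, ← Real.rpow_mul (norm_nonneg _)]
    congr 1
    push_cast
    ring
  simp [e2]
  ring

theorem coordDeriv_inl_normPow (i : Fin n) (p : ℝ) :
    coordDeriv n m (Sum.inl i) (normPow n m p) = p • (normPow n m (p - 2) * coordX n m i) := by
  refine Subtype.ext (funext fun ξ => ?_)
  by_cases hξ : ξ ∈ grushinDomain n m
  · have h := fderiv_apply_eq_evalAt_dirDeriv (isOpen_grushinDomain n m) (eX n m i)
      (normPow n m p) (fun η hη => (evalAt_normPow p hη).symm) hξ
    rw [fderiv_norm_fst_rpow p hξ, evalAt_apply] at h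
    refine h.symm.trans ?_
    simp [normPow, coordX, hξ, eX, EuclideanSpace.inner_single_right]
    ring
  · refine (dirDeriv_apply_of_notMem _ _ _ hξ).trans ?_
    simp [normPow, hξ]

theorem coordDeriv_inr_normPow (μ : Fin m) (p : ℝ) :
    coordDeriv n m (Sum.inr μ) (normPow n m p) = 0 := by
  refine Subtype.ext (funext fun ξ => ?_)
  by_cases hξ : ξ ∈ grushinDomain n m
  · have h := fderiv_apply_eq_evalAt_dirDeriv (isOpen_grushinDomain n m) (eY n m μ)
      (normPow n m p) (fun η hη => (evalAt_normPow p hη).symm) hξ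
    rw [fderiv_norm_fst_rpow p hξ, evalAt_apply] at h
    refine h.symm.trans ?_
    simp [eY]
  · exact dirDeriv_apply_of_notMem _ _ _ hξ

theorem evalAt_coordDeriv_coordX (i j : Fin n) {ξ} (hξ : ξ ∈ grushinDomain n m) :
    evalAt _ ξ (coordDeriv n m (Sum.inl i) (coordX n m j)) = if i = j then 1 else 0 := by
  refine (evalAt_dirDeriv _ _ _ hξ).trans ?_
  have h : HasFDerivAt (coordX n m j).1
      ((EuclideanSpace.proj j : EuclideanSpace ℝ (Fin n) →L[ℝ] ℝ).comp
        (ContinuousLinearMap.fst ℝ _ (EuclideanSpace ℝ (Fin m)))) ξ :=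
    ((EuclideanSpace.proj j : EuclideanSpace ℝ (Fin n) →L[ℝ] ℝ).comp
        (ContinuousLinearMap.fst ℝ _ (EuclideanSpace ℝ (Fin m)))).hasFDerivAt
  rw [h.fderiv]
  simp [eX, eq_comm]

theorem pderiv'_eq_evalAt {f : EuclideanSpace ℝ (Fin n) × EuclideanSpace ℝ (Fin m) → ℝ}
    {F : smoothOn (grushinDomain n m)} (h : ∀ ξ ∈ grushinDomain n m, f ξ = evalAt _ ξ F)
    (A : Fin n ⊕ Fin m) :
    ∀ ξ ∈ grushinDomain n m,
      pderiv' (Sum.elim (eX n m) (eY n m) A) f ξ = evalAt _ ξ (coordDeriv n m A F) :=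
  fun _ hξ => fderiv_apply_eq_evalAt_dirDeriv (isOpen_grushinDomain n m) _ F h hξ

theorem Lop_eq_evalAt (α β : ℝ)
    {f : EuclideanSpace ℝ (Fin n) × EuclideanSpace ℝ (Fin m) → ℝ}
    {F : smoothOn (grushinDomain n m)} (h : ∀ ξ ∈ grushinDomain n m, f ξ = evalAt _ ξ F) :
    ∀ ξ ∈ grushinDomain n m, Lop n m α β f ξ =
      evalAt _ ξ (diffusion (coordDeriv n m) (grushinWeight n m α β) F) := by
  intro ξ hξ
  have h1 := pderiv'_eq_evalAt h
  have h2 := fun A => pderiv'_eq_evalAt (h1 A) A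
  have h1X := fun i => h1 (Sum.inl i) ξ hξ
  have h2X := fun i => h2 (Sum.inl i) ξ hξ
  have h2Y := fun μ => h2 (Sum.inr μ) ξ hξ
  simp only [Sum.elim_inl, Sum.elim_inr] at h1X h2X h2Y
  simp only [Lop, h1X, h2X, h2Y, diffusion, Fintype.sum_sum_type, grushinWeight, Sum.elim_inl,
    Sum.elim_inr, coordDeriv_inl_normPow, coordDeriv_inr_normPow, map_add, map_sum, map_mul,
    map_smul, evalAt_normPow _ hξ, evalAt_coordX, smul_eq_mul, zero_mul, add_zero,
    Finset.sum_const_zero, Finset.sum_add_distrib, Finset.mul_sum]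
  rw [add_right_comm]
  congr 1
  refine Finset.sum_congr rfl fun i _ => ?_
  ring

theorem carre_eq_evalAt (α β : ℝ)
    {f g : EuclideanSpace ℝ (Fin n) × EuclideanSpace ℝ (Fin m) → ℝ}
    {F G : smoothOn (grushinDomain n m)} (hf : ∀ ξ ∈ grushinDomain n m, f ξ = evalAt _ ξ F)
    (hg : ∀ ξ ∈ grushinDomain n m, g ξ = evalAt _ ξ G) :
    ∀ ξ ∈ grushinDomain n m, carre n m α β f g ξ =
      evalAt _ ξ (∑ A, grushinWeight n m α β A * (coordDeriv n m A F * coordDeriv n m A G)) := by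
  intro ξ hξ
  have hfg : ∀ ξ ∈ grushinDomain n m, f ξ * g ξ = evalAt _ ξ (F * G) := fun η hη => by
    rw [map_mul, hf η hη, hg η hη]
  rw [carre, Lop_eq_evalAt α β hfg ξ hξ, Lop_eq_evalAt α β hf ξ hξ, Lop_eq_evalAt α β hg ξ hξ,
    hf ξ hξ, hg ξ hξ, diffusion_mul]
  simp only [map_add, map_mul, map_ofNat]
  ring

theorem carre2_eq_evalAt (α β : ℝ)
    {f : EuclideanSpace ℝ (Fin n) × EuclideanSpace ℝ (Fin m) → ℝ}
    {F : smoothOn (grushinDomain n m)} (hf : ∀ ξ ∈ grushinDomain n m, f ξ = evalAt _ ξ F) :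
    ∀ ξ ∈ grushinDomain n m, carre2 n m α β f ξ =
      evalAt _ ξ (diffusion (coordDeriv n m) (grushinWeight n m α β)
          (∑ B, grushinWeight n m α β B * (coordDeriv n m B F * coordDeriv n m B F))
        - 2 * ∑ B, grushinWeight n m α β B * (coordDeriv n m B F * coordDeriv n m B
            (diffusion (coordDeriv n m) (grushinWeight n m α β) F))) / 2 := by
  intro ξ hξ
  rw [carre2, Lop_eq_evalAt α β (carre_eq_evalAt α β hf hf) ξ hξ,
    carre_eq_evalAt α β hf (Lop_eq_evalAt α β hf) ξ hξ, map_sub, map_mul, map_ofNat]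

theorem evalAt_coordDeriv_inl_normPow (i : Fin n) (p : ℝ) {ξ} (hξ : ξ ∈ grushinDomain n m) :
    evalAt _ ξ (coordDeriv n m (Sum.inl i) (normPow n m p)) =
      p * ‖ξ.1‖ ^ p * (‖ξ.1‖ ^ 2)⁻¹ * ξ.1 i := by
  have hpos : 0 < ‖ξ.1‖ := norm_pos_iff.2 hξ
  rw [coordDeriv_inl_normPow, map_smul, map_mul, evalAt_normPow _ hξ, evalAt_coordX, smul_eq_mul,
    Real.rpow_sub hpos, Real.rpow_two]
  ring

theorem evalAt_coordDeriv_inl_inl_normPow (i j : Fin n) (p : ℝ) {ξ}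
    (hξ : ξ ∈ grushinDomain n m) :
    evalAt _ ξ (coordDeriv n m (Sum.inl j) (coordDeriv n m (Sum.inl i) (normPow n m p))) =
      p * ‖ξ.1‖ ^ p * (‖ξ.1‖ ^ 2)⁻¹ * (if j = i then 1 else 0) +
        p * (p - 2) * ‖ξ.1‖ ^ p * (‖ξ.1‖ ^ 2)⁻¹ ^ 2 * (ξ.1 i * ξ.1 j) := by
  have hpos : 0 < ‖ξ.1‖ := norm_pos_iff.2 hξ
  rw [coordDeriv_inl_normPow, Derivation.map_smul, Derivation.leibniz, map_smul, map_add,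
    smul_eq_mul, smul_eq_mul, smul_eq_mul, map_mul, map_mul, evalAt_normPow _ hξ, evalAt_coordX,
    evalAt_coordDeriv_coordX _ _ hξ, evalAt_coordDeriv_inl_normPow _ _ hξ,
    Real.rpow_sub hpos, Real.rpow_two]
  ring

theorem coordDeriv_comm (A B : Fin n ⊕ Fin m) (F : smoothOn (grushinDomain n m)) :
    coordDeriv n m A (coordDeriv n m B F) = coordDeriv n m B (coordDeriv n m A F) :=
  dirDeriv_comm _ _ _ F

theorem sum_sq_mul_inv_norm_sq {x : EuclideanSpace ℝ (Fin n)} (hx : x ≠ 0) :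
    (∑ i, x i ^ 2) * (‖x‖ ^ 2)⁻¹ = 1 := by
  rw [EuclideanSpace.real_norm_sq_eq]
  refine mul_inv_cancel₀ ?_
  rw [← EuclideanSpace.real_norm_sq_eq]
  exact pow_ne_zero 2 (norm_ne_zero_iff.2 hx)

theorem evalAt_diffusion_normPow (α β p : ℝ) {ξ} (hξ : ξ ∈ grushinDomain n m) :
    evalAt _ ξ (diffusion (coordDeriv n m) (grushinWeight n m α β) (normPow n m p)) =
      p * (n + p - 2 + 2 * α) * (‖ξ.1‖ ^ (2 * α) * ‖ξ.1‖ ^ p * (‖ξ.1‖ ^ 2)⁻¹) := by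
  simp only [diffusion, Fintype.sum_sum_type, grushinWeight, Sum.elim_inl, Sum.elim_inr,
    coordDeriv_inr_normPow, map_add, map_sum, map_mul, map_zero, mul_zero, add_zero,
    Finset.sum_const_zero, evalAt_coordDeriv_inl_normPow _ _ hξ, evalAt_normPow _ hξ,
    evalAt_coordDeriv_inl_inl_normPow _ _ _ hξ, if_true]
  have h := sum_sq_mul_inv_norm_sq hξ
  generalize (‖ξ.1‖ ^ 2)⁻¹ = k at h ⊢
  generalize ‖ξ.1‖ ^ (2 * α) = a
  generalize ‖ξ.1‖ ^ p = b
  have e : ∀ i, a * (p * b * k * 1 + p * (p - 2) * b * k ^ 2 * (ξ.1 i * ξ.1 i)) +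
      2 * α * a * k * ξ.1 i * (p * b * k * ξ.1 i) =
      a * p * b * k + (a * p * (p - 2) * b * k ^ 2 + 2 * α * a * k * p * b * k) * ξ.1 i ^ 2 :=
    fun i => by ring
  simp only [e, Finset.sum_add_distrib, ← Finset.mul_sum, Finset.sum_const, Finset.card_univ,
    Fintype.card_fin, nsmul_eq_mul]
  linear_combination (a * p * (p - 2) * b * k + 2 * α * a * p * b * k) * h

end Grushin

theorem sum_sum_mul_ge {ι κ : Type*} [Fintype ι] [Fintype κ] (x : ι → ℝ) (p : κ → ℝ)
    (X : ι → κ → ℝ) (c : ℝ) :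
    -(∑ i, ∑ j, X i j ^ 2) - c ^ 2 * ((∑ i, x i ^ 2) * ∑ j, p j ^ 2) ≤
      2 * c * ∑ i, ∑ j, x i * p j * X i j := by
  have h : 0 ≤ ∑ i, ∑ j, (X i j + c * (x i * p j)) ^ 2 := by positivity
  have e : ∑ i, ∑ j, (X i j + c * (x i * p j)) ^ 2 =
      ∑ i, ∑ j, X i j ^ 2 + 2 * c * (∑ i, ∑ j, x i * p j * X i j) +
        c ^ 2 * ((∑ i, x i ^ 2) * ∑ j, p j ^ 2) := by
    rw [Finset.sum_mul_sum]
    simp only [Finset.mul_sum, ← Finset.sum_add_distrib]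
    refine Finset.sum_congr rfl fun i _ => Finset.sum_congr rfl fun j _ => ?_
    ring
  linarith

theorem sq_trace_le {ι : Type*} [Fintype ι] (X : ι → ι → ℝ) :
    (∑ i, X i i) ^ 2 ≤ Fintype.card ι * ∑ i, ∑ j, X i j ^ 2 := by
  refine (sq_sum_le_card_mul_sum_sq (s := Finset.univ) (f := fun i => X i i)).trans ?_
  refine mul_le_mul_of_nonneg_left (Finset.sum_le_sum fun i _ => ?_) (Nat.cast_nonneg _)
  exact Finset.single_le_sum (f := fun j => X i j ^ 2) (fun j _ => sq_nonneg _)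
    (Finset.mem_univ i)

/-- The scalar inequality behind the curvature-dimension bound: `P`, `Q` are the squared gradients,
`S` the radial derivative, `t`, `u` the partial Laplacians, `XX`, `YY`, `ZZ` the squared Hessian
blocks, and `T`, `V` the mixed terms. -/
theorem curvature_dimension_scalar {n N a b k α β P Q S t u XX YY ZZ T V : ℝ}
    (hn : 0 ≤ n) (hN : 1 ≤ N) (ha : 0 ≤ a) (hb : 0 ≤ b) (hk : 0 ≤ k)
    (hα : 0 ≤ α) (hα1 : α ≤ 1) (hβ : 0 ≤ β) (hP : 0 ≤ P) (hQ : 0 ≤ Q)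
    (hS : k * S ^ 2 ≤ P) (ht : t ^ 2 ≤ N * XX) (hu : u ^ 2 ≤ N * ZZ)
    (hT : -XX - 16 * α ^ 2 * k * P ≤ 8 * α * k * T)
    (hV : -YY - β ^ 2 * k * Q ≤ 2 * β * k * V) :
    -((1 + 4 * α + 9 * α ^ 2 + 4 * N * (α ^ 2 + β ^ 2) + 2 * β + 2 * β ^ 2) * (a * k)) *
        (a * P + b * Q) + 1 / (12 * N) * (a * t + 2 * α * a * k * S + b * u) ^ 2 ≤
      α * (n + 4 * α - 2) * (a ^ 2 * k) * P + β * (n + 2 * β - 2 + 2 * α) * (a * b * k) * Q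
      + a ^ 2 * XX + 2 * a * b * YY + b ^ 2 * ZZ
      + 4 * α * a ^ 2 * k * T + 4 * β * a * b * k * V
      - 2 * α * a ^ 2 * k * S * t - 2 * β * a * b * k * S * u
      - 2 * α * a ^ 2 * k * P - 2 * α * (2 * α - 2) * a ^ 2 * k ^ 2 * S ^ 2 := by
  have hN0 : 0 < N := by linarith
  have hT' := mul_le_mul_of_nonneg_left hT (by positivity : 0 ≤ a ^ 2 / 2)
  have hV' := mul_le_mul_of_nonneg_left hV (by positivity : 0 ≤ 2 * (a * b))
  have hS' := mul_le_mul_of_nonneg_left hS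
    (by positivity : 0 ≤ (4 * N * (α ^ 2 + β ^ 2) + α ^ 2) * (a ^ 2 * k))
  have ht' : a ^ 2 * t ^ 2 / N ≤ a ^ 2 * XX := by
    rw [div_le_iff₀ hN0]
    nlinarith [mul_le_mul_of_nonneg_left ht (sq_nonneg a)]
  have hu' : b ^ 2 * u ^ 2 / N ≤ b ^ 2 * ZZ := by
    rw [div_le_iff₀ hN0]
    nlinarith [mul_le_mul_of_nonneg_left hu (sq_nonneg b)]
  have hu0 : 0 ≤ b ^ 2 * u ^ 2 / N := by positivity
  have young : ∀ r s : ℝ, 2 * r * s ≤ r ^ 2 / (4 * N) + 4 * N * s ^ 2 := fun r s => by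
    have h : 0 ≤ (r - 4 * N * s) ^ 2 / (4 * N) := by positivity
    have e : (r - 4 * N * s) ^ 2 / (4 * N) = r ^ 2 / (4 * N) + 4 * N * s ^ 2 - 2 * r * s := by
      field_simp
      ring
    linarith
  have h1 := young (a * t) (α * a * k * S)
  have h2 := young (b * u) (β * a * k * S)
  have h3 : 1 / (12 * N) * (a * t + 2 * α * a * k * S + b * u) ^ 2 ≤
      (a * t) ^ 2 / (4 * N) + (b * u) ^ 2 / (4 * N) + α ^ 2 * (a ^ 2 * k) * (k * S ^ 2) := by
    have h4 : (a * t + 2 * α * a * k * S + b * u) ^ 2 ≤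
        3 * ((a * t) ^ 2 + (2 * α * a * k * S) ^ 2 + (b * u) ^ 2) := by
      nlinarith [sq_nonneg (a * t - 2 * α * a * k * S), sq_nonneg (a * t - b * u),
        sq_nonneg (2 * α * a * k * S - b * u)]
    have h5 := mul_le_mul_of_nonneg_left h4 (by positivity : 0 ≤ 1 / (12 * N))
    have h6 : (α * a * k * S) ^ 2 / N ≤ (α * a * k * S) ^ 2 := div_le_self (sq_nonneg _) hN
    have h7 : 1 / (12 * N) * (3 * ((a * t) ^ 2 + (2 * α * a * k * S) ^ 2 + (b * u) ^ 2)) =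
        (a * t) ^ 2 / (4 * N) + (b * u) ^ 2 / (4 * N) + (α * a * k * S) ^ 2 / N := by
      field_simp
      ring
    have h8 : α ^ 2 * (a ^ 2 * k) * (k * S ^ 2) = (α * a * k * S) ^ 2 := by ring
    linarith
  have e1 : (a * t) ^ 2 / (4 * N) = a ^ 2 * t ^ 2 / N / 4 := by
    field_simp
  have e2 : (b * u) ^ 2 / (4 * N) = b ^ 2 * u ^ 2 / N / 4 := by
    field_simp
  rw [e1] at h1 h3
  rw [e2] at h2 h3
  have q1 : 0 ≤ α * (1 - α) * (a ^ 2 * k ^ 2 * S ^ 2) :=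
    mul_nonneg (mul_nonneg hα (by linarith)) (by positivity)
  have q2 : 0 ≤ (α * n + 4 * α ^ 2 + 1 + 2 * β + 2 * β ^ 2) * (a ^ 2 * k * P) := by positivity
  have q3 : 0 ≤ (β * n + 2 * β ^ 2 + 2 * β * α + 1 + 4 * α + 9 * α ^ 2
      + 4 * N * (α ^ 2 + β ^ 2)) * (a * b * k * Q) := by positivity
  linear_combination hT' + hV' + hS' + 1 / 2 * ht' + hu' + 1 / 2 * hu0 + h1 + h2 +
    h3 + 4 * q1 + q2 + q3

/-- Curvature–dimension inequality for the Grushin operator: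
`Γ₂(f) ≥ −(C/|x|^{2(1−α)}) Γ(f) + C' (𝓛f)²` away from `{x = 0}`. -/
theorem curvature_dimension_grushin (n m : ℕ) (hn : 1 ≤ n) (hm : 1 ≤ m)
    (α β : ℝ) (hα : α ∈ Set.Ioo (0 : ℝ) 1) (hβ : 0 ≤ β) :
    ∃ C C' : ℝ, 0 < C ∧ 0 < C' ∧
      ∀ f : EuclideanSpace ℝ (Fin n) × EuclideanSpace ℝ (Fin m) → ℝ,
        ContDiffOn ℝ (⊤ : ℕ∞) f {ξ : EuclideanSpace ℝ (Fin n) × EuclideanSpace ℝ (Fin m) | ξ.1 ≠ 0} →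
        ∀ ξ : EuclideanSpace ℝ (Fin n) × EuclideanSpace ℝ (Fin m), ξ.1 ≠ 0 →
          carre2 n m α β f ξ ≥
            -(C / ‖ξ.1‖ ^ (2 * (1 - α))) * carre n m α β f f ξ
              + C' * (Lop n m α β f ξ) ^ 2 := by
  obtain ⟨hα0, hα1⟩ := hα
  have hN : (1 : ℝ) ≤ n + m := by
    have : (1 : ℝ) ≤ n := by exact_mod_cast hn
    have : (0 : ℝ) ≤ m := Nat.cast_nonneg m
    linarith
  refine ⟨1 + 4 * α + 9 * α ^ 2 + 4 * (n + m) * (α ^ 2 + β ^ 2) + 2 * β + 2 * β ^ 2,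
    1 / (12 * (n + m)), by positivity, by positivity, fun f hf ξ hξ => ?_⟩
  have hpos : 0 < ‖ξ.1‖ := norm_pos_iff.2 hξ
  obtain ⟨F, hF⟩ : ∃ F : smoothOn (grushinDomain n m),
      ∀ η ∈ grushinDomain n m, f η = evalAt _ η F := ⟨⟨f, hf⟩, fun _ _ => rfl⟩
  have hk : ∀ p : ℝ, ‖ξ.1‖ ^ (p - 2) = ‖ξ.1‖ ^ p * (‖ξ.1‖ ^ 2)⁻¹ := fun p => by
    rw [Real.rpow_sub hpos, Real.rpow_two, div_eq_mul_inv]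
  have hC : ∀ c : ℝ, c / ‖ξ.1‖ ^ (2 * (1 - α)) = c * (‖ξ.1‖ ^ (2 * α) * (‖ξ.1‖ ^ 2)⁻¹) :=
    fun c => by
      rw [← hk, div_eq_mul_inv, ← Real.rpow_neg hpos.le]
      congr 2
      ring
  have hx := sum_sq_mul_inv_norm_sq hξ
  have h2 := carre2_eq_evalAt α β hF ξ hξ
  rw [map_diffusion_bochner (coordDeriv n m) coordDeriv_comm (grushinWeight n m α β) (evalAt _ ξ)
    (x := fun i => ξ.1 i) (α := α) (β := β)
    (fun _ => evalAt_normPow (2 * α) hξ) (fun _ => evalAt_normPow (2 * β) hξ)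
    (fun i _ => evalAt_coordDeriv_inl_normPow i (2 * α) hξ)
    (fun i _ => evalAt_coordDeriv_inl_normPow i (2 * β) hξ)
    (fun μ A => by cases A <;> exact coordDeriv_inr_normPow μ _)
    (fun i j => evalAt_coordDeriv_inl_inl_normPow i j (2 * α) hξ)
    (fun _ => evalAt_diffusion_normPow α β (2 * α) hξ)
    (fun _ => evalAt_diffusion_normPow α β (2 * β) hξ)] at h2
  have h1 : carre n m α β f f ξ =
      ‖ξ.1‖ ^ (2 * α) * ∑ i, evalAt _ ξ (coordDeriv n m (Sum.inl i) F) ^ 2 +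
        ‖ξ.1‖ ^ (2 * β) * ∑ μ, evalAt _ ξ (coordDeriv n m (Sum.inr μ) F) ^ 2 := by
    rw [carre_eq_evalAt α β hF hF ξ hξ, map_sum, Fintype.sum_sum_type, Finset.mul_sum,
      Finset.mul_sum]
    simp only [map_mul, grushinWeight, Sum.elim_inl, Sum.elim_inr, evalAt_normPow _ hξ, sq]
  have h0 : Lop n m α β f ξ =
      ‖ξ.1‖ ^ (2 * α) * ∑ i, evalAt _ ξ (coordDeriv n m (Sum.inl i) (coordDeriv n m (Sum.inl i) F))
        + 2 * α * ‖ξ.1‖ ^ (2 * α) * (‖ξ.1‖ ^ 2)⁻¹ *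
          ∑ i, ξ.1 i * evalAt _ ξ (coordDeriv n m (Sum.inl i) F)
        + ‖ξ.1‖ ^ (2 * β) *
          ∑ μ, evalAt _ ξ (coordDeriv n m (Sum.inr μ) (coordDeriv n m (Sum.inr μ) F)) := by
    have d1 := pderiv'_eq_evalAt hF
    have d2 := fun A => pderiv'_eq_evalAt (d1 A) A
    have dX := fun i => d1 (Sum.inl i) ξ hξ
    have dXX := fun i => d2 (Sum.inl i) ξ hξ
    have dYY := fun μ => d2 (Sum.inr μ) ξ hξ
    simp only [Sum.elim_inl, Sum.elim_inr] at dX dXX dYY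
    simp only [Lop, dX, dXX, dYY, hk, mul_assoc]
  rw [h2, h1, h0, hC]
  have hkn : 0 ≤ (‖ξ.1‖ ^ 2)⁻¹ := by positivity
  have ha : 0 ≤ ‖ξ.1‖ ^ (2 * α) := by positivity
  have hb : 0 ≤ ‖ξ.1‖ ^ (2 * β) := by positivity
  generalize (‖ξ.1‖ ^ 2)⁻¹ = k at hx hkn ⊢
  generalize ‖ξ.1‖ ^ (2 * α) = a at ha ⊢
  generalize ‖ξ.1‖ ^ (2 * β) = b at hb ⊢
  generalize evalAt (grushinDomain n m) ξ = e
  generalize coordDeriv n m = D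
  have hS : k * (∑ i, ξ.1 i * e (D (Sum.inl i) F)) ^ 2 ≤
      ∑ i, e (D (Sum.inl i) F) ^ 2 := by
    have h := mul_le_mul_of_nonneg_left (Finset.sum_mul_sq_le_sq_mul_sq Finset.univ
      (fun i => ξ.1 i) (fun i => e (D (Sum.inl i) F))) hkn
    rwa [← mul_assoc, mul_comm k (∑ i, ξ.1 i ^ 2), hx, one_mul] at h
  have htr : ∀ {N M : ℝ} {t s : ℝ}, t ^ 2 ≤ N * s → 0 ≤ M → 0 ≤ s → t ^ 2 ≤ (N + M) * s :=
    fun h hM hs => h.trans (mul_le_mul_of_nonneg_right (by linarith) hs)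
  have ht := sq_trace_le fun i j => e (D (Sum.inl i) (D (Sum.inl j) F))
  have hu := sq_trace_le fun i j => e (D (Sum.inr i) (D (Sum.inr j) F))
  rw [Fintype.card_fin] at ht hu
  have hu' := htr hu (Nat.cast_nonneg n) (by positivity)
  rw [add_comm] at hu'
  have ht' := htr ht (Nat.cast_nonneg m) (by positivity)
  have hT := sum_sum_mul_ge (fun i => ξ.1 i) (fun j => e (D (Sum.inl j) F))
    (fun i j => e (D (Sum.inl i) (D (Sum.inl j) F))) (4 * α * k)
  have hV := sum_sum_mul_ge (fun i => ξ.1 i) (fun j => e (D (Sum.inr j) F))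
    (fun i j => e (D (Sum.inl i) (D (Sum.inr j) F))) (β * k)
  have hmain := curvature_dimension_scalar (n := n) (N := n + m) (a := a) (b := b) (k := k)
    (α := α) (β := β) (Q := ∑ μ, e (D (Sum.inr μ) F) ^ 2)
    (YY := ∑ i, ∑ μ, e (D (Sum.inl i) (D (Sum.inr μ) F)) ^ 2)
    (T := ∑ i, ∑ j, ξ.1 i * e (D (Sum.inl j) F) * e (D (Sum.inl i) (D (Sum.inl j) F)))
    (V := ∑ i, ∑ μ, ξ.1 i * e (D (Sum.inr μ) F) * e (D (Sum.inl i) (D (Sum.inr μ) F)))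
    (Nat.cast_nonneg n) hN ha hb hkn
    hα0.le hα1.le hβ (by positivity) (by positivity) hS
    ht' hu'
    (by linear_combination hT + 16 * α ^ 2 * k *
      (∑ i, e (D (Sum.inl i) F) ^ 2) * hx)
    (by linear_combination hV + β ^ 2 * k *
      (∑ i, e (D (Sum.inr i) F) ^ 2) * hx)
  linear_combination hmain
end
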